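/- arXiv:1803.10798 — 2 statements merged into one kernel-verified Lean document; each statement's English description precedes it below -/
import Mathlib

section
/- Let N ≥ 1 and let F : (ℤ/Nℤ) × (ℤ/Nℤ) × ℍ → ℂ satisfy the SL(2,ℤ)-equivariance F(x, y; (aτ+b)/(cτ+d)) = F(a·x + c·y, b·x + d·y; τ) for all (a b; c d) ∈ SL(2,ℤ), all x, y ∈ ℤ/Nℤ, and all τ ∈ ℍ (matrix entries reduced mod N). For an integer m ≥ 1 define the equivariant Hecke operator (T_m F)(x, y; τ) := (1/m) · ∑_{a,d ≥ 1, ad = m} ∑_{b=0}^{d−1} F(d·x, a·y − b·x; (aτ+b)/d). Then T_m F satisfies the same equivariance: (T_m F)(x, y; (aτ+b)/(cτ+d)) = (T_m F)(a·x + c·y, b·x + d·y; τ) for all (a b; c d) ∈ SL(2,ℤ), x, y ∈ ℤ/Nℤ, τ ∈ ℍ. -/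
open scoped Real

open Matrix in
/-- Upper triangular representatives. -/
def heckeMat (m : ℕ) (p : (_ : ℕ) × ℕ) : Matrix (Fin 2) (Fin 2) ℤ :=
  !![(p.1 : ℤ), (p.2 : ℤ); 0, ((m / p.1 : ℕ) : ℤ)]

/-- The index set. -/
def heckeIdx (m : ℕ) : Finset ((_ : ℕ) × ℕ) :=
  m.divisors.sigma (fun a => Finset.range (m / a))

lemma heckeIdx_mem {m : ℕ} {p : (_ : ℕ) × ℕ} (hp : p ∈ heckeIdx m) :
    0 < p.1 ∧ 0 < m / p.1 ∧ p.1 * (m / p.1) = m ∧ p.2 < m / p.1 := by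
  simp only [heckeIdx, Finset.mem_sigma, Finset.mem_range, Nat.mem_divisors] at hp
  obtain ⟨⟨h1, h2⟩, h3⟩ := hp
  refine ⟨Nat.pos_of_dvd_of_pos h1 (Nat.pos_of_ne_zero h2), by omega, Nat.mul_div_cancel' h1, h3⟩

lemma heckeMat_det {m : ℕ} {p : (_ : ℕ) × ℕ} (hp : p ∈ heckeIdx m) :
    (heckeMat m p).det = m := by
  obtain ⟨_, _, h, _⟩ := heckeIdx_mem hp
  rw [heckeMat, Matrix.det_fin_two_of]
  simp only [mul_zero, sub_zero]
  exact_mod_cast h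

lemma hecke_exists {m : ℕ} (hm : 1 ≤ m) (A : Matrix (Fin 2) (Fin 2) ℤ) (hA : A.det = m) :
    ∃ p ∈ heckeIdx m, ∃ D : Matrix (Fin 2) (Fin 2) ℤ, D.det = 1 ∧ A = D * heckeMat m p := by
  have key : ∀ B : FixedDetMatrix (Fin 2) ℤ (m : ℤ),
      ∃ p ∈ heckeIdx m, ∃ D : Matrix (Fin 2) (Fin 2) ℤ, D.det = 1 ∧ B.1 = D * heckeMat m p := by
    intro B
    have hm0 : (m : ℤ) ≠ 0 := by omega
    induction B using (FixedDetMatrices.induction_on hm0) with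
    | h0 B h1 h2 h3 h4 =>
      have hd := B.2
      rw [Matrix.det_fin_two, h1, mul_zero, sub_zero] at hd
      have hpos : 0 < B.1 1 1 := by
        by_contra hc
        push Not at hc
        nlinarith
      rw [abs_of_nonneg h3, abs_of_pos hpos] at h4
      obtain ⟨a, ha⟩ := Int.eq_ofNat_of_zero_le h2.le
      obtain ⟨b, hb⟩ := Int.eq_ofNat_of_zero_le h3
      obtain ⟨d, hdd⟩ := Int.eq_ofNat_of_zero_le hpos.le
      rw [ha, hdd] at hd
      have hd' : a * d = m := by exact_mod_cast hd
      have ha0 : 0 < a := by omega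
      have hq : m / a = d := by rw [← hd']; exact Nat.mul_div_cancel_left d ha0
      refine ⟨⟨a, b⟩, ?_, 1, by simp, ?_⟩
      · simp only [heckeIdx, Finset.mem_sigma, Finset.mem_range, Nat.mem_divisors]
        refine ⟨⟨⟨d, hd'.symm⟩, by omega⟩, by omega⟩
      · rw [one_mul, heckeMat]
        simp only [hq]
        ext i j
        fin_cases i <;> fin_cases j <;> simp [ha, hb, hdd, h1]
    | hS B hb =>
      obtain ⟨p, hp, D, hD, h⟩ := hb
      refine ⟨p, hp, ModularGroup.S.1 * D, ?_, ?_⟩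
      · rw [Matrix.det_mul, hD, ModularGroup.S.2, one_mul]
      · rw [FixedDetMatrices.smul_coe, h, mul_assoc]
    | hT B hb =>
      obtain ⟨p, hp, D, hD, h⟩ := hb
      refine ⟨p, hp, ModularGroup.T.1 * D, ?_, ?_⟩
      · rw [Matrix.det_mul, hD, ModularGroup.T.2, one_mul]
      · rw [FixedDetMatrices.smul_coe, h, mul_assoc]
  exact key ⟨A, hA⟩

lemma hecke_unique {m : ℕ} {p q : (_ : ℕ) × ℕ} (hp : p ∈ heckeIdx m) (hq : q ∈ heckeIdx m)
    (D : Matrix (Fin 2) (Fin 2) ℤ) (hD : D.det = 1) (h : heckeMat m p = D * heckeMat m q) :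
    p = q := by
  obtain ⟨p1, p2, p3, p4⟩ := heckeIdx_mem hp
  obtain ⟨q1, q2, q3, q4⟩ := heckeIdx_mem hq
  obtain ⟨a, b⟩ := p
  obtain ⟨a', b'⟩ := q
  simp only [heckeMat] at *
  set d := m / a
  set d' := m / a'
  have e00 := congrFun (congrFun h 0) 0
  have e01 := congrFun (congrFun h 0) 1
  have e10 := congrFun (congrFun h 1) 0
  have e11 := congrFun (congrFun h 1) 1
  simp [Matrix.mul_apply, Fin.sum_univ_two] at e00 e01 e10 e11
  rw [Matrix.det_fin_two] at hD
  have h10 : D 1 0 = 0 := by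
    rcases e10 with h | h
    · exact h
    · omega
  rw [h10] at hD e11
  simp only [mul_zero, sub_zero, zero_mul, zero_add] at hD e11
  have h00 : 0 < D 0 0 := by
    by_contra hc
    push Not at hc
    have : (0 : ℤ) < a' := by exact_mod_cast q1
    have : (0 : ℤ) < a := by exact_mod_cast p1
    nlinarith
  have h0 : D 0 0 = 1 ∧ D 1 1 = 1 := by
    rcases Int.mul_eq_one_iff_eq_one_or_neg_one.mp hD with h | h <;> omega
  rw [h0.1] at e00 e01
  rw [h0.2] at e11
  have haa : a = a' := by omega
  have hdd : d = d' := by omega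
  have hu : D 0 1 = 0 := by
    have hd0 : (0 : ℤ) < d' := by exact_mod_cast q2
    have hb1 : (b : ℤ) < d' := by omega
    have hb2 : (b' : ℤ) < d' := by omega
    have h1 : D 0 1 < 1 := by
      by_contra hc
      push Not at hc
      nlinarith
    have h2 : -1 < D 0 1 := by
      by_contra hc
      push Not at hc
      nlinarith
    omega
  rw [hu] at e01
  have hbb : b = b' := by omega
  subst haa hbb
  rfl

lemma den_ne_zero (c d : ℤ) (h : ∃ a b : ℤ, a * d - b * c = 1) (τ : ℂ) (hτ : 0 < τ.im) :
    (c : ℂ) * τ + d ≠ 0 := by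
  obtain ⟨a, b, h⟩ := h
  intro h0
  have him := congrArg Complex.im h0
  have hre := congrArg Complex.re h0
  simp at him hre
  rcases him with hc | hc
  · subst hc
    simp at hre
    subst hre
    simp at h
  · exact hτ.ne' hc

lemma mob_comp (p q r s a b c d : ℂ) (τ : ℂ) (h : c * τ + d ≠ 0) :
    (p * ((a * τ + b) / (c * τ + d)) + q) / (r * ((a * τ + b) / (c * τ + d)) + s) =
    ((p * a + q * c) * τ + (p * b + q * d)) / ((r * a + s * c) * τ + (r * b + s * d)) := by
  have h1 : p * ((a * τ + b) / (c * τ + d)) + q =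
      ((p * a + q * c) * τ + (p * b + q * d)) / (c * τ + d) := by
    rw [eq_div_iff h, add_mul, mul_assoc, div_mul_cancel₀ _ h]
    ring
  have h2 : r * ((a * τ + b) / (c * τ + d)) + s =
      ((r * a + s * c) * τ + (r * b + s * d)) / (c * τ + d) := by
    rw [eq_div_iff h, add_mul, mul_assoc, div_mul_cancel₀ _ h]
    ring
  rw [h1, h2, div_div_div_cancel_right₀ h]

/-- if `F : (ℤ/N) × (ℤ/N) × ℍ → ℂ` is SL(2,ℤ)-equivariant, then so is the
    equivariant Hecke transform
    `(T_m F)(x,y;τ) = (1/m) ∑_{ad = m} ∑_{b=0}^{d−1} F(d·x, a·y − b·x; (aτ+b)/d)`. -/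
theorem statement6 (N : ℕ) (hN : 1 ≤ N) (F : ZMod N → ZMod N → ℂ → ℂ)
    (hF : ∀ (a b c d : ℤ), a * d - b * c = 1 → ∀ (x y : ZMod N) (τ : ℂ), 0 < τ.im →
      F x y ((a * τ + b) / (c * τ + d)) =
        F ((a : ZMod N) * x + (c : ZMod N) * y) ((b : ZMod N) * x + (d : ZMod N) * y) τ)
    (m : ℕ) (hm : 1 ≤ m)
    (T : ZMod N → ZMod N → ℂ → ℂ)
    (hT : ∀ (x y : ZMod N) (τ : ℂ),
      T x y τ = (1 / (m : ℂ)) * ∑ a ∈ m.divisors, ∑ b ∈ Finset.range (m / a),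
        F (((m / a : ℕ) : ZMod N) * x) ((a : ZMod N) * y - (b : ZMod N) * x)
          (((a : ℂ) * τ + (b : ℂ)) / ((m / a : ℕ) : ℂ))) :
    ∀ (a b c d : ℤ), a * d - b * c = 1 → ∀ (x y : ZMod N) (τ : ℂ), 0 < τ.im →
      T x y ((a * τ + b) / (c * τ + d)) =
        T ((a : ZMod N) * x + (c : ZMod N) * y) ((b : ZMod N) * x + (d : ZMod N) * y) τ := by
  intro a b c d hdet x y τ hτ
  set g : Matrix (Fin 2) (Fin 2) ℤ := !![a, b; c, d] with hg
  have hgdet : g.det = 1 := by rw [hg, Matrix.det_fin_two_of]; exact hdet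
  have hex : ∀ p : heckeIdx m, ∃ q : heckeIdx m, ∃ D : Matrix (Fin 2) (Fin 2) ℤ,
      D.det = 1 ∧ heckeMat m p.1 * g = D * heckeMat m q.1 := by
    intro p
    obtain ⟨q, hq, D, hD, h⟩ := hecke_exists hm (heckeMat m p.1 * g)
      (by rw [Matrix.det_mul, hgdet, mul_one, heckeMat_det p.2])
    exact ⟨⟨q, hq⟩, D, hD, h⟩
  choose f D hD hf using hex
  have hinj : Function.Injective f := by
    intro p p' hpp
    have h1 := hf p
    have h2 := hf p'
    rw [← hpp] at h2
    apply Subtype.ext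
    refine hecke_unique p.2 p'.2 (D p * (D p').adjugate) ?_ ?_
    · rw [Matrix.det_mul, Matrix.det_adjugate, hD, hD]; simp
    · have h3 : heckeMat m (f p).1 = (D p').adjugate * (heckeMat m p'.1 * g) := by
        rw [h2, ← mul_assoc, Matrix.adjugate_mul, hD, one_smul, one_mul]
      have h4 : heckeMat m p.1 * g = D p * (D p').adjugate * heckeMat m p'.1 * g := by
        rw [h1, h3]; simp only [mul_assoc]
      have h5 := congrArg (· * g.adjugate) h4
      simpa only [mul_assoc, Matrix.mul_adjugate, hgdet, one_smul, mul_one] using h5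
  have hbij : Function.Bijective f := Finite.injective_iff_bijective.mp hinj
  rw [hT, hT]
  congr 1
  rw [Finset.sum_sigma', Finset.sum_sigma']
  change ∑ p ∈ heckeIdx m, _ = ∑ p ∈ heckeIdx m, _
  rw [← Finset.sum_coe_sort (heckeIdx m), ← Finset.sum_coe_sort (heckeIdx m)]
  refine Fintype.sum_bijective f hbij _ _ ?_
  intro p
  have hp := heckeIdx_mem p.2
  have hq := heckeIdx_mem (f p).2
  have hM := hf p
  have hdetD := hD p
  have hdp := heckeMat_det p.2
  have hdq := heckeMat_det (f p).2
  generalize f p = q at *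
  generalize D p = E at *
  obtain ⟨⟨a₁, b₁⟩, hp'⟩ := p
  obtain ⟨⟨a₂, b₂⟩, hq'⟩ := q
  simp only [heckeMat] at *
  generalize m / a₁ = d₁ at *
  generalize m / a₂ = d₂ at *
  have hden := den_ne_zero c d ⟨a, b, hdet⟩ τ hτ
  -- the adjugate identity
  have hadj : (!![(a₁ : ℤ), (b₁ : ℤ); 0, (d₁ : ℤ)]).adjugate * E =
      g * (!![(a₂ : ℤ), (b₂ : ℤ); 0, (d₂ : ℤ)]).adjugate := by
    have h1 := congrArg Matrix.adjugate hM
    rw [Matrix.adjugate_mul_distrib, Matrix.adjugate_mul_distrib] at h1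
    have h2 := congrArg (fun X => g * X * E) h1
    simp only [mul_assoc, Matrix.adjugate_mul, hdetD, one_smul, mul_one] at h2
    rw [← mul_assoc, Matrix.mul_adjugate, hgdet, one_smul, one_mul] at h2
    exact h2
  have hE : E = !![E 0 0, E 0 1; E 1 0, E 1 1] := Matrix.eta_fin_two E
  rw [Matrix.det_fin_two] at hdetD
  generalize E 0 0 = p at *
  generalize E 0 1 = q at *
  generalize E 1 0 = r at *
  generalize E 1 1 = s at *
  subst hE
  rw [Matrix.adjugate_fin_two_of, Matrix.adjugate_fin_two_of, hg] at hadj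
  rw [hg] at hM
  simp only [Matrix.mul_fin_two] at hadj hM
  have k00 := congrFun (congrFun hadj 0) 0
  have k01 := congrFun (congrFun hadj 0) 1
  have k10 := congrFun (congrFun hadj 1) 0
  have k11 := congrFun (congrFun hadj 1) 1
  have l00 := congrFun (congrFun hM 0) 0
  have l01 := congrFun (congrFun hM 0) 1
  have l10 := congrFun (congrFun hM 1) 0
  have l11 := congrFun (congrFun hM 1) 1
  simp only [Matrix.of_apply, Matrix.cons_val', Matrix.cons_val_zero, Matrix.cons_val_one,
    Matrix.cons_val_fin_one] at k00 k01 k10 k11 l00 l01 l10 l11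
  have hd2 : ((0 : ℂ) * τ + (d₂ : ℂ)) ≠ 0 := by
    rw [zero_mul, zero_add]
    exact_mod_cast hq.2.1.ne'
  have him : 0 < (((a₂ : ℂ) * τ + b₂) / (d₂ : ℂ)).im := by
    rw [Complex.div_natCast_im]
    have h1 : (0 : ℝ) < a₂ := by exact_mod_cast hq.1
    have h2 : (0 : ℝ) < d₂ := by exact_mod_cast hq.2.1
    simp
    positivity
  have e1 := mob_comp a₁ b₁ 0 d₁ a b c d τ hden
  have e2 := mob_comp p q r s a₂ b₂ 0 d₂ τ hd2
  apply_fun (Int.cast : ℤ → ℂ) at l00 l01 l10 l11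
  apply_fun (Int.cast : ℤ → ZMod N) at k00 k01 k10 k11
  push_cast at l00 l01 l10 l11 k00 k01 k10 k11
  rw [l00, l01, l10, l11, ← e2] at e1
  simp only [zero_mul, zero_add] at e1
  rw [e1, hF p q r s hdetD _ _ _ him]
  congr 1
  · linear_combination x * k00 + y * k10
  · linear_combination x * k01 + y * k11
end

section
/- Let N ≥ 1 and let c : (ℤ/Nℤ) × (ℤ/Nℤ) × ((1/N)ℤ) → ℂ satisfy the periodicity c_{x,y}(h)·exp(2πih) = c_{x,y+x}(h) for all x, y ∈ ℤ/Nℤ and h ∈ (1/N)ℤ, and assume that for every Y > 0, ∑_{h ∈ (1/N)ℤ} |c_{x,y}(h)|·exp(−2πhY) < ∞ for all x, y. Then for all x, w ∈ ℤ/Nℤ, all positive integers a, d, and all τ ∈ ℍ, (1/d)·∑_{b=0}^{d−1} ∑_{n ∈ ℤ} exp(2πin(aτ+b)/(Nd))·c_{d·x, w − b·x}(n/N) = (1/N)·∑_{b=0}^{N−1} ∑_{r ∈ ℤ} exp(2πir(aτ+b)/N)·c_{d·x, w − b·x}(rd/N), both sides converging absolutely. -/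
open scoped Real

lemma aux_shift (G : ℕ → ℂ) (q : ℂ) (m : ℕ) (h : ∀ b, G (b + m) = q * G b) (k b : ℕ) :
    G (m * k + b) = q ^ k * G b := by
  induction k with
  | zero => simp
  | succ k ih =>
    rw [show m * (k + 1) + b = (m * k + b) + m by ring, h, ih]; ring

lemma aux_sum (G : ℕ → ℂ) (q : ℂ) (m : ℕ) (h : ∀ b, G (b + m) = q * G b) (k : ℕ) :
    ∑ b ∈ Finset.range (m * k), G b
      = (∑ j ∈ Finset.range k, q ^ j) * ∑ b ∈ Finset.range m, G b := by
  induction k with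
  | zero => simp
  | succ k ih =>
    rw [mul_add_one, Finset.sum_range_add, ih, Finset.sum_range_succ, add_mul]
    congr 1
    rw [Finset.mul_sum]
    exact Finset.sum_congr rfl fun b _ => aux_shift G q m h k b

lemma aux_geom (d : ℕ) (hd : 1 ≤ d) (n : ℤ) :
    ∑ j ∈ Finset.range d, (Complex.exp (2 * Real.pi * Complex.I * n / d)) ^ j
      = if (d : ℤ) ∣ n then (d : ℂ) else 0 := by
  have hd0 : (d : ℂ) ≠ 0 := by exact_mod_cast (by omega : d ≠ 0)
  have hpi : (2 * Real.pi * Complex.I : ℂ) ≠ 0 := Complex.two_pi_I_ne_zero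
  split_ifs with hdv
  · obtain ⟨r, rfl⟩ := hdv
    have : Complex.exp (2 * Real.pi * Complex.I * ((d * r : ℤ) : ℂ) / d) = 1 := by
      rw [Complex.exp_eq_one_iff]
      refine ⟨r, ?_⟩
      push_cast
      field_simp
    rw [this]; simp
  · have hne : Complex.exp (2 * Real.pi * Complex.I * n / d) ≠ 1 := by
      intro h
      rw [Complex.exp_eq_one_iff] at h
      obtain ⟨r, hr⟩ := h
      apply hdv
      refine ⟨r, ?_⟩
      rw [div_eq_iff hd0] at hr
      have : (2 * Real.pi * Complex.I : ℂ) * n = (2 * Real.pi * Complex.I) * (d * r) := by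
        rw [hr]; ring
      have := mul_left_cancel₀ hpi this
      exact_mod_cast this
    rw [geom_sum_eq hne, ← Complex.exp_nat_mul, mul_div_cancel₀ _ hd0]
    have : Complex.exp (2 * Real.pi * Complex.I * n) = 1 := by
      rw [Complex.exp_eq_one_iff]; exact ⟨n, by ring⟩
    rw [this]; simp

lemma aux_norm (N d a b : ℕ) (hN : 1 ≤ N) (hd : 1 ≤ d) (τ : ℂ) (n : ℤ) :
    ‖Complex.exp (2 * Real.pi * Complex.I * n * ((a : ℂ) * τ + (b : ℂ)) / ((N : ℂ) * d))‖
      = Real.exp (-2 * Real.pi * ((n : ℝ) / N) * (a * τ.im / d)) := by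
  rw [Complex.norm_exp]
  congr 1
  have : (2 * Real.pi * Complex.I * n * ((a : ℂ) * τ + (b : ℂ)) / ((N : ℂ) * d))
    = ((2 * Real.pi * n / (N * d) : ℝ) : ℂ) * (Complex.I * ((a : ℂ) * τ + (b : ℂ))) := by
    push_cast; ring
  rw [this, Complex.re_ofReal_mul]
  simp
  ring

/-- the resummation identity
    `(1/d) ∑_{b=0}^{d−1} ∑_{n∈ℤ} e^{2πin(aτ+b)/(Nd)} c_{dx, w−bx}(n/N)
      = (1/N) ∑_{b=0}^{N−1} ∑_{r∈ℤ} e^{2πir(aτ+b)/N} c_{dx, w−bx}(rd/N)`,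
    both sides converging absolutely.  Here `c x y n` stands for `c_{x,y}(n/N)`. -/
theorem statement8 (N : ℕ) (hN : 1 ≤ N)
    (c : ZMod N → ZMod N → ℤ → ℂ)
    -- periodicity `c_{x,y}(h)·e^{2πih} = c_{x,y+x}(h)` with `h = n/N`
    (hper : ∀ (x y : ZMod N) (n : ℤ),
      c x y n * Complex.exp (2 * Real.pi * Complex.I * n / N) = c x (y + x) n)
    -- growth: `∑_h |c_{x,y}(h)| e^{−2πhY} < ∞` for every `Y > 0`
    (hgrow : ∀ Y : ℝ, 0 < Y → ∀ x y : ZMod N,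
      Summable (fun n : ℤ => ‖c x y n‖ * Real.exp (-2 * Real.pi * ((n : ℝ) / N) * Y))) :
    ∀ (x w : ZMod N) (a d : ℕ), 1 ≤ a → 1 ≤ d → ∀ τ : ℂ, 0 < τ.im →
      (∀ b ∈ Finset.range d, Summable (fun n : ℤ =>
        ‖Complex.exp (2 * Real.pi * Complex.I * n * ((a : ℂ) * τ + (b : ℂ)) / ((N : ℂ) * d)) *
            c ((d : ZMod N) * x) (w - (b : ZMod N) * x) n‖)) ∧
      (∀ b ∈ Finset.range N, Summable (fun r : ℤ =>
        ‖Complex.exp (2 * Real.pi * Complex.I * r * ((a : ℂ) * τ + (b : ℂ)) / (N : ℂ)) *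
            c ((d : ZMod N) * x) (w - (b : ZMod N) * x) (r * d)‖)) ∧
      (1 / (d : ℂ)) * ∑ b ∈ Finset.range d, ∑' n : ℤ,
          Complex.exp (2 * Real.pi * Complex.I * n * ((a : ℂ) * τ + (b : ℂ)) / ((N : ℂ) * d)) *
            c ((d : ZMod N) * x) (w - (b : ZMod N) * x) n
        = (1 / (N : ℂ)) * ∑ b ∈ Finset.range N, ∑' r : ℤ,
          Complex.exp (2 * Real.pi * Complex.I * r * ((a : ℂ) * τ + (b : ℂ)) / (N : ℂ)) *
            c ((d : ZMod N) * x) (w - (b : ZMod N) * x) (r * d) := by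
  intro x w a d ha hd τ hτ
  have hd0 : (d : ℂ) ≠ 0 := by exact_mod_cast (by omega : d ≠ 0)
  have hN0 : (N : ℂ) ≠ 0 := by exact_mod_cast (by omega : N ≠ 0)
  have hdZ : (d : ℤ) ≠ 0 := by exact_mod_cast (by omega : d ≠ 0)
  have hS : ∀ b : ℕ, Summable (fun n : ℤ =>
        ‖Complex.exp (2 * Real.pi * Complex.I * n * ((a : ℂ) * τ + (b : ℂ)) / ((N : ℂ) * d)) *
            c ((d : ZMod N) * x) (w - (b : ZMod N) * x) n‖) := by
    intro b
    have hY : 0 < (a : ℝ) * τ.im / d := by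
      have : (0 : ℝ) < a := by exact_mod_cast ha
      have : (0 : ℝ) < d := by exact_mod_cast hd
      positivity
    refine (hgrow _ hY ((d : ZMod N) * x) (w - (b : ZMod N) * x)).congr fun n => ?_
    rw [norm_mul, aux_norm N d a b hN hd, mul_comm]
  have hinj : Function.Injective (fun r : ℤ => r * (d : ℤ)) := mul_left_injective₀ hdZ
  have hE : ∀ (b : ℕ) (r : ℤ),
      Complex.exp (2 * Real.pi * Complex.I * r * ((a : ℂ) * τ + (b : ℂ)) / (N : ℂ))
      = Complex.exp (2 * Real.pi * Complex.I * ((r * d : ℤ) : ℂ) * ((a : ℂ) * τ + (b : ℂ))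
          / ((N : ℂ) * d)) := by
    intro b r
    congr 1
    push_cast
    field_simp
  have hS2 : ∀ b : ℕ, Summable (fun r : ℤ =>
        ‖Complex.exp (2 * Real.pi * Complex.I * r * ((a : ℂ) * τ + (b : ℂ)) / (N : ℂ)) *
            c ((d : ZMod N) * x) (w - (b : ZMod N) * x) (r * d)‖) := by
    intro b
    refine ((hS b).comp_injective hinj).congr fun r => ?_
    simp only [Function.comp]
    rw [hE]
  refine ⟨fun b _ => hS b, fun b _ => hS2 b, ?_⟩
  rw [← Summable.tsum_finsetSum (fun b _ => (hS b).of_norm),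
    ← Summable.tsum_finsetSum (fun b _ => (hS2 b).of_norm), ← tsum_mul_left, ← tsum_mul_left]
  set G : ℤ → ℕ → ℂ := fun n b =>
    Complex.exp (2 * Real.pi * Complex.I * n * ((a : ℂ) * τ + (b : ℂ)) / ((N : ℂ) * d)) *
            c ((d : ZMod N) * x) (w - (b : ZMod N) * x) n with hG
  have h1 : ∀ n b, G n (b + d) = 1 * G n b := by
    intro n b
    simp only [hG]
    have := hper ((d : ZMod N) * x) (w - ((b + d : ℕ) : ZMod N) * x) n
    rw [show w - ((b + d : ℕ) : ZMod N) * x + (d : ZMod N) * x = w - (b : ZMod N) * x by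
      push_cast; ring] at this
    rw [← this, one_mul, mul_comm (c _ _ _), ← mul_assoc, ← Complex.exp_add]
    congr 2
    push_cast
    field_simp
    ring
  have h2 : ∀ n b, G n (b + N) = Complex.exp (2 * Real.pi * Complex.I * n / d) * G n b := by
    intro n b
    simp only [hG]
    rw [← mul_assoc, ← Complex.exp_add]
    congr 2
    · push_cast
      field_simp
      ring
    · push_cast
      simp
  have key : ∀ n : ℤ, (1 / (d : ℂ)) * ∑ b ∈ Finset.range d, G n b
      = if (d : ℤ) ∣ n then (1 / (N : ℂ)) * ∑ b ∈ Finset.range N, G n b else 0 := by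
    intro n
    have e1 := aux_sum (G n) _ d (h1 n) N
    have e2 := aux_sum (G n) _ N (h2 n) d
    rw [aux_geom d hd, mul_comm N d, e1] at e2
    simp only [one_pow, Finset.sum_const, Finset.card_range, nsmul_eq_mul, mul_one] at e2
    split_ifs at e2 ⊢ with h
    · field_simp
      linear_combination e2
    · have : ∑ b ∈ Finset.range d, G n b = 0 := by
        rw [zero_mul] at e2
        exact (mul_eq_zero.mp e2).resolve_left hN0
      rw [this, mul_zero]
  rw [tsum_congr key, ← hinj.tsum_eq]
  · refine tsum_congr fun r => ?_
    rw [if_pos (Dvd.intro_left r rfl)]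
    congr 1
    refine Finset.sum_congr rfl fun b _ => ?_
    rw [hE]
  · intro n hn
    rw [Function.mem_support] at hn
    by_cases h : (d : ℤ) ∣ n
    · obtain ⟨r, rfl⟩ := h
      exact ⟨r, mul_comm _ _⟩
    · exact absurd (if_neg h) hn
end
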